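/- Let B_k = ℂ[x, y, y₁, …, y_k] (k ≥ 4) with the five derivations v₁, …, v₅ defined on generators by: v₁(x) = 1 and v₁ vanishes on all other variables; v₂(y) = 1 and v₂ vanishes on all other variables; v₃(y) = x, v₃(y₁) = 1, and v₃ vanishes on all other variables; v₄(x) = y, v₄(y) = 0, v₄(y_j) = ψ_j, where ψ₁ = −y₁² and ψ_{j+1} = D(ψ_j) − y₁·y_{j+1} with D the total derivative determined by D(x) = 1, D(y) = y₁, D(y_j) = y_{j+1}; v₅(x) = x, v₅(y) = −y, v₅(y_j) = −(j+1)·y_j. Extend v₁, …, v₅ uniquely to derivations of the rational function field K_k = ℂ(x, y, y₁, …, y_k). Set R₂ = y₂, R₄ = 3y₂y₄ − 5y₃², I₄ = R₄³/R₂⁸, and recursively I_{j+1} = (R₄/R₂³)·D(I_j) for j ≥ 4 (so I_j ∈ ℂ(y₂, …, y_j)). Then a rational function f ∈ K_k satisfies v_i(f) = 0 for all i = 1, …, 5 if and only if f belongs to the subfield ℂ(I₄, I₅, …, I_k). In other words, the field of rational absolute differential invariants of order k of the special affine group acting on plane curves is generated by I₄ and the invariant derivation (R₄/R₂³)·D.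 -/

import Mathlib

open MvPolynomial

/-- The polynomial ring `B_k = ℂ[x, y, y₁, …, y_k]`, with variable indices
`0 ↦ x`, `1 ↦ y`, `j+1 ↦ y_j` for `1 ≤ j ≤ k`. -/
abbrev B (k : ℕ) : Type := MvPolynomial (Fin (k + 2)) ℂ

/-- The rational function field `K_k = ℂ(x, y, y₁, …, y_k)`. -/
abbrev K (k : ℕ) : Type := FractionRing (B k)

/-- The embedding `B_k → K_k`. -/
noncomputable def ι (k : ℕ) : B k →+* K k := algebraMap (B k) (K k)

/-- The variable `x` in `K_k`. -/
noncomputable def xK (k : ℕ) : K k := ι k (X ⟨0, by omega⟩)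

/-- The variable `y` in `K_k`. -/
noncomputable def yK (k : ℕ) : K k := ι k (X ⟨1, by omega⟩)

/-- The jet variable `y_j` in `K_k` (for `1 ≤ j ≤ k`). -/
noncomputable def yjK (k j : ℕ) : K k :=
  if h : 1 ≤ j ∧ j ≤ k then ι k (X ⟨j + 1, by omega⟩) else 0

/-- `R₂ = y₂`. -/
noncomputable def R2 (k : ℕ) : K k := yjK k 2

/-- `R₄ = 3y₂y₄ − 5y₃²`. -/
noncomputable def R4 (k : ℕ) : K k := 3 * yjK k 2 * yjK k 4 - 5 * yjK k 3 ^ 2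

/-- A derivation of the field `K_k`: an additive map satisfying the Leibniz rule. -/
def IsDeriv {F : Type*} [Field F] (v : F → F) : Prop :=
  (∀ a b : F, v (a + b) = v a + v b) ∧ (∀ a b : F, v (a * b) = v a * b + a * v b)

section JetFields

variable {F : Type*} [Field F]

/-- A derivation of a field that vanishes on a set vanishes on the subfield it generates. -/
theorem derivation_eq_zero_of_mem_closure (v : Derivation ℤ F F) {S : Set F}
    (hS : ∀ s ∈ S, v s = 0) {f : F} (hf : f ∈ Subfield.closure S) : v f = 0 := by
  induction hf using Subfield.closure_induction with
  | mem x hx => exact hS x hx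
  | one => exact v.map_one_eq_zero
  | add x y _ _ hx hy => rw [map_add, hx, hy, add_zero]
  | neg x _ hx => rw [map_neg, hx, neg_zero]
  | inv x _ hx => rw [v.leibniz_inv, hx, smul_zero]
  | mul x y _ _ hx hy => rw [v.leibniz, hx, hy, smul_zero, smul_zero, add_zero]

/-- Chain rule for a derivation killing the coefficients of a polynomial. -/
theorem derivation_aeval {E : Type*} [Field E] [Algebra E F] (v : Derivation ℤ F F)
    (hE : ∀ e, v (algebraMap E F e) = 0) (t : F) (p : Polynomial E) :
    v (Polynomial.aeval t p) = Polynomial.aeval t (Polynomial.derivative p) * v t := by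
  induction p using Polynomial.induction_on' with
  | add p q hp hq => simp only [map_add, hp, hq, add_mul]
  | monomial n a =>
    have ha : v (algebraMap E F a) = 0 := hE a
    rw [Polynomial.aeval_monomial, Polynomial.derivative_monomial, Polynomial.aeval_monomial,
      v.leibniz, ha, v.leibniz_pow]
    simp only [smul_eq_mul, nsmul_eq_mul, map_mul, map_natCast]
    ring

/-- An element moved by a derivation killing `E` is transcendental over `E`. -/
theorem eq_zero_of_aeval_eq_zero_of_derivation {E : Type*} [Field E] [CharZero E] [Algebra E F]
    (v : Derivation ℤ F F) (hE : ∀ e, v (algebraMap E F e) = 0) {t : F} (ht : v t ≠ 0)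
    (p : Polynomial E) (hp : Polynomial.aeval t p = 0) : p = 0 := by
  obtain ⟨n, hn⟩ : ∃ n, p.natDegree = n := ⟨_, rfl⟩
  induction n using Nat.strong_induction_on generalizing p with
  | _ n ih =>
    have hd : Polynomial.aeval t (Polynomial.derivative p) = 0 := by
      have h := derivation_aeval v hE t p
      rw [hp, map_zero] at h
      exact (mul_eq_zero.mp h.symm).resolve_right ht
    have hconst : p.natDegree = 0 := by
      by_contra hne
      have h0 := ih _ (hn ▸ Polynomial.natDegree_derivative_lt hne) _ hd rfl
      exact hne (Polynomial.derivative_eq_zero.mp h0)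
    rw [Polynomial.eq_C_of_natDegree_eq_zero hconst, Polynomial.aeval_C] at hp
    rw [Polynomial.eq_C_of_natDegree_eq_zero hconst,
      (map_eq_zero (algebraMap E F)).mp hp, Polynomial.C_0]

theorem exists_isCoprime_of_right_ne_zero {E : Type*} [Field E] (r : Polynomial E)
    {s : Polynomial E} (hs : s ≠ 0) :
    ∃ p q g : Polynomial E, g ≠ 0 ∧ IsCoprime p q ∧ r = g * p ∧ s = g * q := by
  classical
  have hg : EuclideanDomain.gcd r s ≠ 0 := fun h => hs (EuclideanDomain.gcd_eq_zero_iff.mp h).2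
  obtain ⟨p, hp⟩ := EuclideanDomain.gcd_dvd_left r s
  obtain ⟨q, hq⟩ := EuclideanDomain.gcd_dvd_right r s
  have hab := EuclideanDomain.gcd_eq_gcd_ab r s
  generalize EuclideanDomain.gcdA r s = a at hab
  generalize EuclideanDomain.gcdB r s = b at hab
  generalize EuclideanDomain.gcd r s = g at *
  refine ⟨p, q, g, hg, ⟨a, b, mul_left_cancel₀ hg ?_⟩, hp, hq⟩
  rw [hp, hq] at hab
  linear_combination -hab

/-- In characteristic zero, constants of a derivation on a simple extension `E(t)` lie in `E`
when the derivation kills `E` but not `t`. -/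
theorem mem_range_of_mem_adjoin_simple {E : Type*} [Field E] [CharZero E] [Algebra E F]
    (v : Derivation ℤ F F) (hE : ∀ e, v (algebraMap E F e) = 0) {t : F} (ht : v t ≠ 0) {f : F}
    (hmem : f ∈ IntermediateField.adjoin E {t}) (hvf : v f = 0) : f ∈ (algebraMap E F).range := by
  have hzero := eq_zero_of_aeval_eq_zero_of_derivation v hE ht
  obtain ⟨r, s, rfl⟩ := (IntermediateField.mem_adjoin_simple_iff E f).mp hmem
  by_cases hs : s = 0
  · simp [hs, zero_mem]
  obtain ⟨p, q, g, hg, hpq, rfl, rfl⟩ := exists_isCoprime_of_right_ne_zero r hs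
  have hq : q ≠ 0 := right_ne_zero_of_mul hs
  have hgt : Polynomial.aeval t g ≠ 0 := fun h => hg (hzero g h)
  have hqt : Polynomial.aeval t q ≠ 0 := fun h => hq (hzero q h)
  have hsimp : Polynomial.aeval t (g * p) / Polynomial.aeval t (g * q) =
      Polynomial.aeval t p / Polynomial.aeval t q := by
    rw [map_mul, map_mul, mul_div_mul_left _ _ hgt]
  rw [hsimp] at hvf ⊢
  have hder : Polynomial.derivative p * q = p * Polynomial.derivative q := by
    have h : Polynomial.aeval t (Polynomial.derivative p * q - p * Polynomial.derivative q) = 0 := by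
      rw [v.leibniz_div, derivation_aeval v hE, derivation_aeval v hE, smul_eq_mul,
        smul_eq_mul, smul_eq_mul] at hvf
      have h1 := (mul_eq_zero.mp hvf).resolve_left (pow_ne_zero 2 (inv_ne_zero hqt))
      simp only [map_sub, map_mul]
      apply mul_right_cancel₀ ht
      linear_combination h1
    exact sub_eq_zero.mp (hzero _ h)
  have hq' : Polynomial.derivative q = 0 := by
    have hdvd : q ∣ Polynomial.derivative q :=
      hpq.symm.dvd_of_dvd_mul_left (Dvd.intro_left _ hder)
    by_contra hne
    exact absurd (Polynomial.degree_le_of_dvd hdvd hne)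
      (not_le.mpr (Polynomial.degree_derivative_lt hq))
  have hp' : Polynomial.derivative p = 0 := by
    rw [hq', mul_zero] at hder
    exact (mul_eq_zero.mp hder).resolve_right hq
  rw [Polynomial.eq_C_of_natDegree_eq_zero (Polynomial.derivative_eq_zero.mp hq'),
    Polynomial.eq_C_of_natDegree_eq_zero (Polynomial.derivative_eq_zero.mp hp'),
    Polynomial.aeval_C, Polynomial.aeval_C]
  exact ⟨p.coeff 0 / q.coeff 0, map_div₀ _ _ _⟩

theorem mem_of_mem_closure_insert [CharZero F] (E : Subfield F) (v : Derivation ℤ F F)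
    (hE : ∀ e ∈ E, v e = 0) {t : F} (ht : v t ≠ 0) {f : F}
    (hf : f ∈ Subfield.closure (insert t (E : Set F))) (hvf : v f = 0) : f ∈ E := by
  have hle : Subfield.closure (insert t (E : Set F)) ≤
      (IntermediateField.adjoin E {t}).toSubfield := by
    rw [Subfield.closure_le]
    rintro z (rfl | hz)
    · exact IntermediateField.mem_adjoin_simple_self E z
    · exact (IntermediateField.adjoin E {t}).algebraMap_mem ⟨z, hz⟩
  obtain ⟨e, rfl⟩ := mem_range_of_mem_adjoin_simple v (fun e : E => hE e e.2) ht (hle hf) hvf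
  exact e.2

/-- The field of functions of `x, y, y₁, …, y_n` over a set of constants, with `y 0 = y`. -/
def jetField (S : Set F) (x : F) (y : ℕ → F) (n : ℕ) : Subfield F :=
  Subfield.closure (insert x (S ∪ y '' Set.Iic n))

variable {S : Set F} {x : F} {y : ℕ → F} {k : ℕ}

theorem jet_mem_jetField {j n : ℕ} (h : j ≤ n) : y j ∈ jetField S x y n :=
  Subfield.subset_closure (Or.inr (Or.inr ⟨j, h, rfl⟩))

theorem jetField_le {n : ℕ} {M : Subfield F} (hx : x ∈ M) (hS : S ⊆ M)
    (hy : ∀ j ≤ n, y j ∈ M) : jetField S x y n ≤ M := by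
  rw [jetField, Subfield.closure_le]
  rintro z (rfl | hz | ⟨j, hj, rfl⟩)
  · exact hx
  · exact hS hz
  · exact hy j hj

theorem jetField_mono {m n : ℕ} (h : m ≤ n) : jetField S x y m ≤ jetField S x y n :=
  jetField_le (Subfield.subset_closure (Or.inl rfl))
    (fun _ hz => Subfield.subset_closure (Or.inr (Or.inl hz)))
    fun _ hj => jet_mem_jetField (hj.trans h)

theorem derivation_mem_jetField {D : Derivation ℤ F F} (hDS : ∀ s ∈ S, D s = 0)
    (hDx : D x = 1) (hDy : ∀ j < k, D (y j) = y (j + 1)) {n : ℕ} (hn : n < k) {f : F}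
    (hf : f ∈ jetField S x y n) : D f ∈ jetField S x y (n + 1) := by
  have hle := jetField_mono (S := S) (x := x) (y := y) n.le_succ
  rw [jetField] at hf
  induction hf using Subfield.closure_induction with
  | mem z hz =>
    rcases hz with rfl | hz | ⟨j, hj, rfl⟩
    · rw [hDx]; exact one_mem _
    · rw [hDS z hz]; exact zero_mem _
    · rw [hDy j (lt_of_le_of_lt hj hn)]
      exact jet_mem_jetField (Nat.succ_le_succ hj)
  | one => rw [D.map_one_eq_zero]; exact zero_mem _
  | add a b _ _ ha hb => rw [map_add]; exact add_mem ha hb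
  | neg a _ ha => rw [map_neg]; exact neg_mem ha
  | inv a hm ha =>
    rw [D.leibniz_inv]
    exact mul_mem (neg_mem (pow_mem (inv_mem (hle hm)) 2)) ha
  | mul a b hma hmb ha hb =>
    rw [D.leibniz]
    exact add_mem (mul_mem (hle hma) hb) (mul_mem (hle hmb) ha)

/-- A prolonged vector field commutes with the total derivative up to `D (v x)`. -/
theorem derivation_commutator {D v : Derivation ℤ F F} (hDS : ∀ s ∈ S, D s = 0)
    (hvS : ∀ s ∈ S, v s = 0) (hDx : D x = 1) (hDy : ∀ j < k, D (y j) = y (j + 1))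
    (hvy : ∀ j < k, v (y (j + 1)) = D (v (y j)) - D (v x) * y (j + 1))
    {n : ℕ} (hn : n < k) {f : F} (hf : f ∈ jetField S x y n) :
    v (D f) = D (v f) - D (v x) * D f := by
  have h := derivation_eq_zero_of_mem_closure (⁅v, D⁆ + D (v x) • D) (f := f) ?_ hf
  · rw [Derivation.add_apply, Derivation.commutator_apply, Derivation.smul_apply,
      smul_eq_mul] at h
    linear_combination h
  · intro z hz
    rw [Derivation.add_apply, Derivation.commutator_apply, Derivation.smul_apply, smul_eq_mul]
    rcases hz with rfl | hz | ⟨j, hj, rfl⟩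
    · rw [hDx, v.map_one_eq_zero]; ring
    · rw [hDS z hz, hvS z hz, map_zero, map_zero]; ring
    · have hj' := lt_of_le_of_lt hj hn
      rw [hDy j hj', hvy j hj']; ring

variable {D : Derivation ℤ F F} {R : F} {I : ℕ → F}

theorem relativeInvariant_mem_jetField (hR : R = 3 * y 2 * y 4 - 5 * y 3 ^ 2) : R ∈ jetField S x y 4 := by
  have h2 : y 2 ∈ jetField S x y 4 := jet_mem_jetField (by omega)
  have h3 : y 3 ∈ jetField S x y 4 := jet_mem_jetField (by omega)
  have h4 : y 4 ∈ jetField S x y 4 := jet_mem_jetField (by omega)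
  rw [hR]
  exact sub_mem (mul_mem (mul_mem (ofNat_mem _ 3) h2) h4) (mul_mem (ofNat_mem _ 5) (pow_mem h3 2))

theorem invariant_mem_jetField (hDS : ∀ s ∈ S, D s = 0)
    (hDx : D x = 1) (hDy : ∀ j < k, D (y j) = y (j + 1))
    (hR : R = 3 * y 2 * y 4 - 5 * y 3 ^ 2) (hI4 : I 4 = R ^ 3 / y 2 ^ 8)
    (hIrec : ∀ j, 4 ≤ j → j < k → I (j + 1) = (R / y 2 ^ 3) * D (I j))
    {j : ℕ} (hj : 4 ≤ j) (hjk : j ≤ k) : I j ∈ jetField S x y j := by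
  have hRm : R ∈ jetField S x y 4 := relativeInvariant_mem_jetField hR
  induction j, hj using Nat.le_induction with
  | base =>
    rw [hI4]
    exact div_mem (pow_mem hRm 3) (pow_mem (jet_mem_jetField (by omega)) 8)
  | succ j hj ih =>
    rw [hIrec j hj (by omega)]
    exact mul_mem (div_mem (jetField_mono (by omega) hRm)
      (pow_mem (jet_mem_jetField (by omega)) 3))
      (derivation_mem_jetField hDS hDx hDy (by omega) (ih (by omega)))

/-- The functions `I_j` are invariants of any prolonged vector field for which `y₂` and `R₄`
are relative invariants of weights `-3` and `-8`. -/
theorem derivation_invariant_eq_zero (hDS : ∀ s ∈ S, D s = 0)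
    (hDx : D x = 1) (hDy : ∀ j < k, D (y j) = y (j + 1))
    (hy2 : y 2 ≠ 0)
    (hR : R = 3 * y 2 * y 4 - 5 * y 3 ^ 2) (hI4 : I 4 = R ^ 3 / y 2 ^ 8)
    (hIrec : ∀ j, 4 ≤ j → j < k → I (j + 1) = (R / y 2 ^ 3) * D (I j))
    {v : Derivation ℤ F F} (hvS : ∀ s ∈ S, v s = 0)
    (hvy : ∀ j < k, v (y (j + 1)) = D (v (y j)) - D (v x) * y (j + 1))
    (hv2 : v (y 2) = -3 * D (v x) * y 2) (hvR : v R = -8 * D (v x) * R)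
    {j : ℕ} (hj : 4 ≤ j) (hjk : j ≤ k) : v (I j) = 0 := by
  induction j, hj using Nat.le_induction with
  | base =>
    rw [hI4, v.leibniz_div, v.leibniz_pow, v.leibniz_pow, hv2, hvR]
    simp only [smul_eq_mul, nsmul_eq_mul]
    push_cast
    ring
  | succ j hj ih =>
    have hc := derivation_commutator hDS hvS hDx hDy hvy (Nat.lt_of_succ_le hjk)
      (invariant_mem_jetField hDS hDx hDy hR hI4 hIrec hj (by omega))
    rw [ih (by omega), map_zero] at hc
    rw [hIrec j hj (by omega), v.leibniz, hc, v.leibniz_div, v.leibniz_pow, hv2, hvR]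
    simp only [smul_eq_mul, nsmul_eq_mul]
    push_cast
    field_simp
    ring

/-- For `j ≥ 5` the invariant `I_j` is affine in the top jet variable `y_j`. -/
theorem invariant_affine [CharZero F] (hDS : ∀ s ∈ S, D s = 0)
    (hDx : D x = 1) (hDy : ∀ j < k, D (y j) = y (j + 1))
    (hy2 : y 2 ≠ 0) (hR0 : R ≠ 0)
    (hR : R = 3 * y 2 * y 4 - 5 * y 3 ^ 2) (hI4 : I 4 = R ^ 3 / y 2 ^ 8)
    (hIrec : ∀ j, 4 ≤ j → j < k → I (j + 1) = (R / y 2 ^ 3) * D (I j))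
    {j : ℕ} (hj : 4 ≤ j) (hjk : j < k) :
    ∃ a ∈ jetField S x y j, ∃ b ∈ jetField S x y j, a ≠ 0 ∧ I (j + 1) = a * y (j + 1) + b := by
  induction j, hj using Nat.le_induction with
  | base =>
    have hRm : R ∈ jetField S x y 4 := relativeInvariant_mem_jetField hR
    have h2 : y 2 ∈ jetField S x y 4 := jet_mem_jetField (by omega)
    have h3 : y 3 ∈ jetField S x y 4 := jet_mem_jetField (by omega)
    have h4 : y 4 ∈ jetField S x y 4 := jet_mem_jetField (by omega)
    have hDR : D R = 3 * y 2 * y 5 - 7 * y 3 * y 4 := by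
      rw [hR]
      have e3 : D (3 : F) = 0 := D.map_natCast 3
      have e5 : D (5 : F) = 0 := D.map_natCast 5
      simp only [map_sub, D.leibniz, D.leibniz_pow, e3, e5, hDy 2 (by omega),
        hDy 3 (by omega), hDy 4 (by omega), smul_eq_mul, nsmul_eq_mul]
      push_cast
      ring
    refine ⟨9 * R ^ 3 / y 2 ^ 10, ?_,
      R ^ 3 * (-21 * y 3 * y 4) / y 2 ^ 11 - 8 * R ^ 4 * y 3 / y 2 ^ 12, ?_, ?_, ?_⟩
    · exact div_mem (mul_mem (ofNat_mem _ 9) (pow_mem hRm 3)) (pow_mem h2 10)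
    · exact sub_mem (div_mem (mul_mem (pow_mem hRm 3)
        (mul_mem (mul_mem (neg_mem (ofNat_mem _ 21)) h3) h4)) (pow_mem h2 11))
        (div_mem (mul_mem (mul_mem (ofNat_mem _ 8) (pow_mem hRm 4)) h3) (pow_mem h2 12))
    · exact div_ne_zero (mul_ne_zero (by norm_num) (pow_ne_zero 3 hR0)) (pow_ne_zero 10 hy2)
    · rw [hIrec 4 le_rfl hjk, hI4, D.leibniz_div, D.leibniz_pow, D.leibniz_pow, hDR,
        hDy 2 (by omega)]
      simp only [smul_eq_mul, nsmul_eq_mul]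
      push_cast
      field_simp
      ring
  | succ j hj ih =>
    obtain ⟨a, ha, b, hb, ha0, hI⟩ := ih (by omega)
    have hu : R / y 2 ^ 3 ∈ jetField S x y (j + 1) :=
      div_mem (jetField_mono (by omega) (relativeInvariant_mem_jetField hR))
        (pow_mem (jet_mem_jetField (by omega)) 3)
    refine ⟨R / y 2 ^ 3 * a, mul_mem hu (jetField_mono j.le_succ ha),
      R / y 2 ^ 3 * (D a * y (j + 1) + D b), mul_mem hu (add_mem (mul_mem
        (derivation_mem_jetField hDS hDx hDy (by omega) ha) (jet_mem_jetField le_rfl))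
        (derivation_mem_jetField hDS hDx hDy (by omega) hb)),
      mul_ne_zero (div_ne_zero hR0 (pow_ne_zero 3 hy2)) ha0, ?_⟩
    rw [hIrec (j + 1) (by omega) hjk, hI, map_add, D.leibniz, hDy (j + 1) hjk, smul_eq_mul,
      smul_eq_mul]
    ring

/-- The jet field is generated by the invariants and `x, y, y₁, y₃, R₄ / y₂³`. -/
theorem jetField_le_of_invariant_mem [CharZero F] (hDS : ∀ s ∈ S, D s = 0)
    (hDx : D x = 1) (hDy : ∀ j < k, D (y j) = y (j + 1))
    (hy2 : y 2 ≠ 0) (hR0 : R ≠ 0) (hk : 4 ≤ k)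
    (hR : R = 3 * y 2 * y 4 - 5 * y 3 ^ 2) (hI4 : I 4 = R ^ 3 / y 2 ^ 8)
    (hIrec : ∀ j, 4 ≤ j → j < k → I (j + 1) = (R / y 2 ^ 3) * D (I j))
    {M : Subfield F} (hSM : S ⊆ M) (hIM : ∀ j, 4 ≤ j → j ≤ k → I j ∈ M) (hx : x ∈ M)
    (h0 : y 0 ∈ M) (h1 : y 1 ∈ M) (h3 : y 3 ∈ M) (hu : R / y 2 ^ 3 ∈ M) :
    jetField S x y k ≤ M := by
  have h2 : y 2 ∈ M := by
    have h : y 2 = I 4 / (R / y 2 ^ 3) ^ 3 := by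
      rw [hI4]; field_simp
    rw [h]
    exact div_mem (hIM 4 le_rfl hk) (pow_mem hu 3)
  have h4 : y 4 ∈ M := by
    have h : y 4 = ((R / y 2 ^ 3) * y 2 ^ 3 + 5 * y 3 ^ 2) / (3 * y 2) := by
      rw [div_mul_cancel₀ _ (pow_ne_zero 3 hy2), hR]; field_simp; ring
    rw [h]
    exact div_mem (add_mem (mul_mem hu (pow_mem h2 3)) (mul_mem (ofNat_mem _ 5) (pow_mem h3 2)))
      (mul_mem (ofNat_mem _ 3) h2)
  have key : ∀ n, 4 ≤ n → n ≤ k → jetField S x y n ≤ M := by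
    intro n hn
    induction n, hn using Nat.le_induction with
    | base =>
      intro _
      refine jetField_le hx hSM fun j hj => ?_
      interval_cases j <;> assumption
    | succ n hn ih =>
      intro hnk
      have hle := ih (by omega)
      refine jetField_le hx hSM fun j hj => ?_
      rcases Nat.lt_or_eq_of_le hj with hj | rfl
      · exact hle (jet_mem_jetField (Nat.le_of_lt_succ hj))
      · obtain ⟨a, ha, b, hb, ha0, hI⟩ :=
          invariant_affine hDS hDx hDy hy2 hR0 hR hI4 hIrec hn (Nat.lt_of_succ_le hnk)
        have h : y (n + 1) = (I (n + 1) - b) / a := by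
          rw [hI]; field_simp; ring
        rw [h]
        exact div_mem (sub_mem (hIM _ (by omega) hnk) (hle hb)) (hle ha)
  exact key k hk le_rfl

/-- The field of rational special affine differential invariants, over any field of
characteristic zero generated by jet coordinates. -/
theorem special_affine_invariants [CharZero F] (hDS : ∀ s ∈ S, D s = 0)
    (hDx : D x = 1) (hDy : ∀ j < k, D (y j) = y (j + 1))
    (hy2 : y 2 ≠ 0) (hR0 : R ≠ 0) (hk : 4 ≤ k) (htop : jetField S x y k = ⊤)
    (hR : R = 3 * y 2 * y 4 - 5 * y 3 ^ 2) (hI4 : I 4 = R ^ 3 / y 2 ^ 8)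
    (hIrec : ∀ j, 4 ≤ j → j < k → I (j + 1) = (R / y 2 ^ 3) * D (I j))
    {v₁ v₂ v₃ v₄ v₅ : Derivation ℤ F F}
    (hS₁ : ∀ s ∈ S, v₁ s = 0) (hS₂ : ∀ s ∈ S, v₂ s = 0) (hS₃ : ∀ s ∈ S, v₃ s = 0)
    (hS₄ : ∀ s ∈ S, v₄ s = 0) (hS₅ : ∀ s ∈ S, v₅ s = 0)
    (hx₁ : v₁ x = 1) (hy₁ : ∀ j ≤ k, v₁ (y j) = 0)
    (hx₂ : v₂ x = 0) (hy₂ : v₂ (y 0) = 1) (hyj₂ : ∀ j, 1 ≤ j → j ≤ k → v₂ (y j) = 0)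
    (hx₃ : v₃ x = 0) (hy₃ : v₃ (y 0) = x) (hy1₃ : v₃ (y 1) = 1)
    (hyj₃ : ∀ j, 2 ≤ j → j ≤ k → v₃ (y j) = 0)
    (hx₄ : v₄ x = y 0) (hy₄ : v₄ (y 0) = 0)
    (hyj₄ : ∀ j < k, v₄ (y (j + 1)) = D (v₄ (y j)) - y 1 * y (j + 1))
    (hx₅ : v₅ x = x) (hyj₅ : ∀ j ≤ k, v₅ (y j) = -(((j : F) + 1) * y j)) (f : F) :
    (v₁ f = 0 ∧ v₂ f = 0 ∧ v₃ f = 0 ∧ v₄ f = 0 ∧ v₅ f = 0) ↔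
      f ∈ Subfield.closure (S ∪ I '' Set.Icc 4 k) := by
  have ofNat_zero : ∀ (v : Derivation ℤ F F), v (3 : F) = 0 ∧ v (5 : F) = 0 :=
    fun v => ⟨v.map_natCast 3, v.map_natCast 5⟩
  have hvR : ∀ v : Derivation ℤ F F, v R =
      3 * (v (y 2) * y 4 + y 2 * v (y 4)) - 10 * y 3 * v (y 3) := by
    intro v
    rw [hR]
    simp only [map_sub, v.leibniz, v.leibniz_pow, (ofNat_zero v).1, (ofNat_zero v).2,
      smul_eq_mul, nsmul_eq_mul]
    push_cast
    ring
  have hD3 : ∀ z, D (3 * z) = 3 * D z := fun z => by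
    rw [D.leibniz, (ofNat_zero D).1, smul_zero, add_zero, smul_eq_mul]
  have h41 : v₄ (y 1) = -(y 1 * y 1) := by
    rw [hyj₄ 0 (by omega), hy₄, map_zero]; ring
  have h42 : v₄ (y 2) = -(3 * (y 1 * y 2)) := by
    rw [hyj₄ 1 (by omega), h41, map_neg, D.leibniz, hDy 1 (by omega), smul_eq_mul]; ring
  have h43 : v₄ (y 3) = -(3 * (y 2 * y 2)) - 4 * y 1 * y 3 := by
    rw [hyj₄ 2 (by omega), h42, map_neg, hD3, D.leibniz, hDy 1 (by omega), hDy 2 (by omega),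
      smul_eq_mul, smul_eq_mul]
    ring
  have h44 : v₄ (y 4) = -10 * y 2 * y 3 - 5 * y 1 * y 4 := by
    have hD4 : D (4 : F) = 0 := D.map_natCast 4
    rw [hyj₄ 3 (by omega), h43, map_sub, map_neg, hD3]
    simp only [D.leibniz, hDy 1 (by omega), hDy 2 (by omega), hDy 3 (by omega), hD4, smul_eq_mul]
    ring
  have h4R : v₄ R = -8 * y 1 * R := by
    rw [hvR, h42, h43, h44, hR]; ring
  have h52 : v₅ (y 2) = -3 * y 2 := by
    rw [hyj₅ 2 (by omega)]; push_cast; ring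
  have h53 : v₅ (y 3) = -4 * y 3 := by
    rw [hyj₅ 3 (by omega)]; push_cast; ring
  have h5R : v₅ R = -8 * R := by
    rw [hvR, h52, h53, hyj₅ 4 (by omega), hR]; push_cast; ring
  have hinv : ∀ v : Derivation ℤ F F, (∀ s ∈ S, v s = 0) →
      (∀ j < k, v (y (j + 1)) = D (v (y j)) - D (v x) * y (j + 1)) →
      v (y 2) = -3 * D (v x) * y 2 → v R = -8 * D (v x) * R →
      ∀ f ∈ Subfield.closure (S ∪ I '' Set.Icc 4 k), v f = 0 := by
    intro v hvS hvy hv2 hvR f hf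
    refine derivation_eq_zero_of_mem_closure v ?_ hf
    rintro z (hz | ⟨j, hj, rfl⟩)
    · exact hvS z hz
    · exact derivation_invariant_eq_zero hDS hDx hDy hy2 hR hI4 hIrec hvS hvy hv2 hvR hj.1 hj.2
  have hL₁ := hinv v₁ hS₁
    (fun j hj => by rw [hy₁ _ hj, hy₁ _ hj.le, hx₁, D.map_one_eq_zero, map_zero]; ring)
    (by rw [hy₁ _ (by omega), hx₁, D.map_one_eq_zero]; ring)
    (by rw [hvR, hy₁ 2 (by omega), hy₁ 3 (by omega), hy₁ 4 hk, hx₁, D.map_one_eq_zero]; ring)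
  have hL₂ := hinv v₂ hS₂
    (fun j hj => by
      rw [hyj₂ (j + 1) (by omega) hj, hx₂, map_zero]
      rcases j.eq_zero_or_pos with rfl | hj0
      · rw [hy₂, D.map_one_eq_zero]; ring
      · rw [hyj₂ j hj0 hj.le, map_zero]; ring)
    (by rw [hyj₂ 2 (by omega) (by omega), hx₂, map_zero]; ring)
    (by rw [hvR, hyj₂ 2 (by omega) (by omega), hyj₂ 3 (by omega) (by omega),
          hyj₂ 4 (by omega) hk, hx₂, map_zero]; ring)
  have hL₃ := hinv v₃ hS₃
    (fun j hj => by
      rw [hx₃, map_zero]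
      rcases j.eq_zero_or_pos with rfl | hj0
      · rw [hy1₃, hy₃, hDx]; ring
      · rw [hyj₃ (j + 1) (by omega) hj]
        rcases Nat.lt_or_eq_of_le (Nat.succ_le_of_lt hj0) with h | rfl
        · rw [hyj₃ j h hj.le, map_zero]; ring
        · rw [hy1₃, D.map_one_eq_zero]; ring)
    (by rw [hyj₃ 2 (by omega) (by omega), hx₃, map_zero]; ring)
    (by rw [hvR, hyj₃ 2 (by omega) (by omega), hyj₃ 3 (by omega) (by omega),
          hyj₃ 4 (by omega) hk, hx₃, map_zero]; ring)
  have hD0 : D (y 0) = y 1 := hDy 0 (by omega)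
  have hL₄ := hinv v₄ hS₄
    (fun j hj => by rw [hyj₄ j hj, hx₄, hD0])
    (by rw [h42, hx₄, hD0]; ring) (by rw [h4R, hx₄, hD0])
  have hL₅ := hinv v₅ hS₅
    (fun j hj => by
      rw [hyj₅ _ hj, hyj₅ _ hj.le, hx₅, hDx, map_neg, D.leibniz, hDy j hj, map_add,
        D.map_natCast, D.map_one_eq_zero, smul_eq_mul, smul_eq_mul]
      push_cast
      ring)
    (by rw [h52, hx₅, hDx]; ring) (by rw [h5R, hx₅, hDx]; ring)
  refine ⟨?_, fun hf => ⟨hL₁ f hf, hL₂ f hf, hL₃ f hf, hL₄ f hf, hL₅ f hf⟩⟩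
  rintro ⟨hf₁, hf₂, hf₃, hf₄, hf₅⟩
  set L := Subfield.closure (S ∪ I '' Set.Icc 4 k)
  have hv_u : ∀ (v : Derivation ℤ F F) (c : F), v (y 2) = -3 * c * y 2 → v R = -8 * c * R →
      v (R / y 2 ^ 3) = c * (R / y 2 ^ 3) := by
    intro v c h2 h
    rw [v.leibniz_div, v.leibniz_pow, h2, h]
    simp only [smul_eq_mul, nsmul_eq_mul]
    push_cast
    field_simp
    ring
  obtain ⟨u, hu⟩ : ∃ u, u = R / y 2 ^ 3 := ⟨_, rfl⟩
  have hu0 : u ≠ 0 := hu ▸ div_ne_zero hR0 (pow_ne_zero 3 hy2)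
  rw [← hu] at hv_u
  have hu₁ : v₁ u = 0 := by
    rw [hv_u v₁ 0 (by rw [hy₁ _ (by omega)]; ring)
      (by rw [hvR, hy₁ 2 (by omega), hy₁ 3 (by omega), hy₁ 4 hk]; ring), zero_mul]
  have hu₂ : v₂ u = 0 := by
    rw [hv_u v₂ 0 (by rw [hyj₂ 2 (by omega) (by omega)]; ring)
      (by rw [hvR, hyj₂ 2 (by omega) (by omega), hyj₂ 3 (by omega) (by omega),
          hyj₂ 4 (by omega) hk]; ring), zero_mul]
  have hu₃ : v₃ u = 0 := by
    rw [hv_u v₃ 0 (by rw [hyj₃ 2 (by omega) (by omega)]; ring)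
      (by rw [hvR, hyj₃ 2 (by omega) (by omega), hyj₃ 3 (by omega) (by omega),
          hyj₃ 4 (by omega) hk]; ring), zero_mul]
  have hu₄ : v₄ u = y 1 * u := hv_u v₄ (y 1) (by rw [h42]; ring) h4R
  have hu₅ : v₅ u = u := by
    rw [hv_u v₅ 1 (by rw [h52]; ring) (by rw [h5R]; ring), one_mul]
  have hins : ∀ (v : Derivation ℤ F F) (E : Subfield F) (t : F), (∀ e ∈ E, v e = 0) → v t = 0 →
      ∀ e ∈ Subfield.closure (insert t (E : Set F)), v e = 0 := by
    intro v E t hE ht e he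
    refine derivation_eq_zero_of_mem_closure v ?_ he
    rintro z (rfl | hz)
    · exact ht
    · exact hE z hz
  have hsub : ∀ (E : Subfield F) (t : F), E ≤ Subfield.closure (insert t (E : Set F)) :=
    fun E t z hz => Subfield.subset_closure (Or.inr hz)
  have hself : ∀ (E : Subfield F) (t : F), t ∈ Subfield.closure (insert t (E : Set F)) :=
    fun E t => Subfield.subset_closure (Or.inl rfl)
  obtain ⟨E₁, hE₁⟩ : ∃ E, E = Subfield.closure (insert u (L : Set F)) := ⟨_, rfl⟩
  obtain ⟨E₂, hE₂⟩ : ∃ E, E = Subfield.closure (insert (y 3) (E₁ : Set F)) := ⟨_, rfl⟩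
  obtain ⟨E₃, hE₃⟩ : ∃ E, E = Subfield.closure (insert (y 1) (E₂ : Set F)) := ⟨_, rfl⟩
  obtain ⟨E₄, hE₄⟩ : ∃ E, E = Subfield.closure (insert (y 0) (E₃ : Set F)) := ⟨_, rfl⟩
  have hm₅ : f ∈ Subfield.closure (insert x (E₄ : Set F)) := by
    have l4 := hsub E₄ x
    have l3 : E₃ ≤ _ := (hE₄ ▸ hsub E₃ (y 0)).trans l4
    have l2 : E₂ ≤ _ := (hE₃ ▸ hsub E₂ (y 1)).trans l3
    have l1 : E₁ ≤ _ := (hE₂ ▸ hsub E₁ (y 3)).trans l2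
    have l0 : L ≤ _ := (hE₁ ▸ hsub L u).trans l1
    have hle := jetField_le_of_invariant_mem hDS hDx hDy hy2 hR0 hk hR hI4 hIrec
      (M := Subfield.closure (insert x (E₄ : Set F)))
      (fun z hz => l0 (Subfield.subset_closure (Or.inl hz)))
      (fun j hj hjk => l0 (Subfield.subset_closure (Or.inr ⟨j, ⟨hj, hjk⟩, rfl⟩)))
      (hself E₄ x) (l4 (hE₄ ▸ hself E₃ (y 0))) (l3 (hE₃ ▸ hself E₂ (y 1)))
      (l2 (hE₂ ▸ hself E₁ (y 3))) (hu ▸ l1 (hE₁ ▸ hself L u))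
    exact hle (htop ▸ Subfield.mem_top f)
  have hm₄ : f ∈ E₄ := by
    refine mem_of_mem_closure_insert E₄ v₁ ?_ (by rw [hx₁]; exact one_ne_zero) hm₅ hf₁
    rw [hE₄]; refine hins _ _ _ ?_ (hy₁ 0 (by omega))
    rw [hE₃]; refine hins _ _ _ ?_ (hy₁ 1 (by omega))
    rw [hE₂]; refine hins _ _ _ ?_ (hy₁ 3 (by omega))
    rw [hE₁]; exact hins _ _ _ hL₁ hu₁
  have hm₃ : f ∈ E₃ := by
    refine mem_of_mem_closure_insert E₃ v₂ ?_ (by rw [hy₂]; exact one_ne_zero) (hE₄ ▸ hm₄) hf₂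
    rw [hE₃]; refine hins _ _ _ ?_ (hyj₂ 1 (by omega) (by omega))
    rw [hE₂]; refine hins _ _ _ ?_ (hyj₂ 3 (by omega) (by omega))
    rw [hE₁]; exact hins _ _ _ hL₂ hu₂
  have hm₂ : f ∈ E₂ := by
    refine mem_of_mem_closure_insert E₂ v₃ ?_ (by rw [hy1₃]; exact one_ne_zero) (hE₃ ▸ hm₃) hf₃
    rw [hE₂]; refine hins _ _ _ ?_ (hyj₃ 3 (by omega) (by omega))
    rw [hE₁]; exact hins _ _ _ hL₃ hu₃
  have happ : ∀ z, (v₄ - y 1 • v₅) z = v₄ z - y 1 * v₅ z := fun z => by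
    rw [Derivation.sub_apply, Derivation.smul_apply, smul_eq_mul]
  have hm₁ : f ∈ E₁ := by
    refine mem_of_mem_closure_insert E₁ (v₄ - y 1 • v₅) ?_ ?_ (hE₂ ▸ hm₂) ?_
    · rw [hE₁]
      refine hins _ _ _ (fun e he => ?_) ?_
      · rw [happ, hL₄ e he, hL₅ e he]; ring
      · rw [happ, hu₄, hu₅, sub_self]
    · have h : (v₄ - y 1 • v₅) (y 3) = -3 * y 2 ^ 2 := by
        rw [happ, h43, h53]; ring
      rw [h]
      exact mul_ne_zero (by norm_num) (pow_ne_zero 2 hy2)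
    · rw [happ, hf₄, hf₅]; ring
  exact mem_of_mem_closure_insert L v₅ hL₅ (by rw [hu₅]; exact hu0) (hE₁ ▸ hm₁) hf₅

/-- An additive map satisfying the Leibniz rule, as a bundled derivation. -/
def IsDeriv.toDerivation {v : F → F} (h : IsDeriv v) : Derivation ℤ F F :=
  Derivation.mk' (AddMonoidHom.mk' v h.1).toIntLinearMap fun a b => by
    change v (a * b) = a * v b + b * v a
    rw [h.2]; ring

@[simp]
theorem IsDeriv.toDerivation_apply {v : F → F} (h : IsDeriv v) (f : F) :
    h.toDerivation f = v f := rfl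

theorem IsDeriv.map_zero {v : F → F} (h : IsDeriv v) : v 0 = 0 :=
  h.toDerivation.map_zero

end JetFields

/-- The jet variables `y = y₀, y₁, …, y_k` of `K_k`. -/
noncomputable def jetVar (k j : ℕ) : K k := if j = 0 then yK k else yjK k j

theorem jetVar_of_pos {k j : ℕ} (h : 1 ≤ j) : jetVar k j = yjK k j :=
  if_neg (by omega)

theorem ι_injective (k : ℕ) : Function.Injective (ι k) :=
  IsFractionRing.injective (B k) (K k)

theorem jetVar_eq {k j : ℕ} (h : j ≤ k) : jetVar k j = ι k (X ⟨j + 1, by omega⟩) := by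
  rcases j.eq_zero_or_pos with rfl | hj
  · rfl
  · rw [jetVar_of_pos hj, yjK, dif_pos ⟨hj, h⟩]

theorem jetField_eq_top (k : ℕ) :
    jetField (Set.range fun c : ℂ => ι k (C c)) (xK k) (jetVar k) k = ⊤ := by
  rw [eq_top_iff]
  set M := jetField (Set.range fun c : ℂ => ι k (C c)) (xK k) (jetVar k) k
  have hpoly : ∀ p : B k, ι k p ∈ M := by
    intro p
    induction p using MvPolynomial.induction_on with
    | C c => exact Subfield.subset_closure (Or.inr (Or.inl ⟨c, rfl⟩))
    | add p q hp hq => rw [map_add]; exact add_mem hp hq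
    | mul_X p i hp =>
      rw [map_mul]
      refine mul_mem hp ?_
      obtain ⟨i, hi⟩ := i
      rcases i with _ | i
      · exact Subfield.subset_closure (Or.inl rfl)
      · rw [← jetVar_eq (k := k) (j := i) (by omega)]
        exact jet_mem_jetField (by omega)
  intro f _
  obtain ⟨p, q, _, rfl⟩ := IsFractionRing.div_surjective (A := B k) f
  exact div_mem (hpoly p) (hpoly q)

theorem R4_ne_zero {k : ℕ} (hk : 4 ≤ k) : R4 k ≠ 0 := by
  have h : R4 k = ι k (3 * X ⟨3, by omega⟩ * X ⟨5, by omega⟩ - 5 * X ⟨4, by omega⟩ ^ 2) := by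
    rw [R4, ← jetVar_of_pos (by omega), ← jetVar_of_pos (by omega), ← jetVar_of_pos (by omega),
      jetVar_eq (j := 2) (by omega), jetVar_eq (j := 3) (by omega), jetVar_eq hk]
    simp only [map_sub, map_mul, map_pow, map_ofNat]
  rw [h]
  intro h0
  have h1 := congrArg (eval fun i => if i.1 = 4 then (1 : ℂ) else 0)
    (ι_injective k (h0.trans (map_zero (ι k)).symm))
  simp at h1

theorem R2_ne_zero {k : ℕ} (hk : 2 ≤ k) : R2 k ≠ 0 := by
  rw [R2, ← jetVar_of_pos (by omega), jetVar_eq hk]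
  exact (map_ne_zero_iff _ (ι_injective k)).mpr (X_ne_zero _)

/-- Let `v₁, …, v₅` be the (prolonged) special affine derivations of
`K_k = ℂ(x, y, y₁, …, y_k)` (`k ≥ 4`), given on generators as in the hypotheses, and let
`D` be the total derivative.  Set `R₂ = y₂`, `R₄ = 3y₂y₄ − 5y₃²`, `I₄ = R₄³/R₂⁸` and
`I_{j+1} = (R₄/R₂³)·D(I_j)`.  Then `f ∈ K_k` satisfies `v_i(f) = 0` for all `i` if and
only if `f` belongs to the subfield `ℂ(I₄, I₅, …, I_k)`. -/
theorem saff_rational_invariants_generated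
    (k : ℕ) (hk : 4 ≤ k)
    (D v1 v2 v3 v4 v5 : K k → K k) (ψ I : ℕ → K k)
    (hD : IsDeriv D) (h1 : IsDeriv v1) (h2 : IsDeriv v2) (h3 : IsDeriv v3)
    (h4 : IsDeriv v4) (h5 : IsDeriv v5)
    (hconst : ∀ c : ℂ, D (ι k (C c)) = 0 ∧ v1 (ι k (C c)) = 0 ∧ v2 (ι k (C c)) = 0 ∧
      v3 (ι k (C c)) = 0 ∧ v4 (ι k (C c)) = 0 ∧ v5 (ι k (C c)) = 0)
    (hDx : D (xK k) = 1) (hDy : D (yK k) = yjK k 1)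
    (hDj : ∀ j, 1 ≤ j → j < k → D (yjK k j) = yjK k (j + 1))
    (hψ1 : ψ 1 = -(yjK k 1) ^ 2)
    (hψrec : ∀ j, 1 ≤ j → j + 1 ≤ k → ψ (j + 1) = D (ψ j) - yjK k 1 * yjK k (j + 1))
    (hv1x : v1 (xK k) = 1) (hv1y : v1 (yK k) = 0)
    (hv1j : ∀ j, 1 ≤ j → j ≤ k → v1 (yjK k j) = 0)
    (hv2x : v2 (xK k) = 0) (hv2y : v2 (yK k) = 1)
    (hv2j : ∀ j, 1 ≤ j → j ≤ k → v2 (yjK k j) = 0)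
    (hv3x : v3 (xK k) = 0) (hv3y : v3 (yK k) = xK k)
    (hv31 : v3 (yjK k 1) = 1)
    (hv3j : ∀ j, 2 ≤ j → j ≤ k → v3 (yjK k j) = 0)
    (hv4x : v4 (xK k) = yK k) (hv4y : v4 (yK k) = 0)
    (hv4j : ∀ j, 1 ≤ j → j ≤ k → v4 (yjK k j) = ψ j)
    (hv5x : v5 (xK k) = xK k) (hv5y : v5 (yK k) = -(yK k))
    (hv5j : ∀ j, 1 ≤ j → j ≤ k → v5 (yjK k j) = -(((j : K k) + 1) * yjK k j))
    (hI4 : I 4 = R4 k ^ 3 / R2 k ^ 8)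
    (hIrec : ∀ j, 4 ≤ j → j < k → I (j + 1) = (R4 k / R2 k ^ 3) * D (I j)) :
    ∀ f : K k,
      (v1 f = 0 ∧ v2 f = 0 ∧ v3 f = 0 ∧ v4 f = 0 ∧ v5 f = 0) ↔
      f ∈ Subfield.closure ((Set.range fun c : ℂ => ι k (C c)) ∪ (I '' Set.Icc 4 k)) := by
  have hj : ∀ j, 1 ≤ j → jetVar k j = yjK k j := fun j h => jetVar_of_pos h
  have : CharZero (K k) := charZero_of_injective_algebraMap (R := B k) (ι_injective k)
  refine special_affine_invariants (D := hD.toDerivation) (v₁ := h1.toDerivation)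
    (v₂ := h2.toDerivation) (v₃ := h3.toDerivation) (v₄ := h4.toDerivation)
    (v₅ := h5.toDerivation) (x := xK k) (y := jetVar k) (R := R4 k)
    ?_ hDx ?_ ?_ (R4_ne_zero hk) hk (jetField_eq_top k) ?_ ?_ ?_ ?_ ?_ ?_ ?_ ?_ hv1x ?_
    hv2x hv2y ?_ hv3x hv3y hv31 ?_ hv4x hv4y ?_ hv5x ?_
  · rintro _ ⟨c, rfl⟩
    exact (hconst c).1
  · intro j hjk
    rcases j.eq_zero_or_pos with rfl | h
    · exact hDy
    · rw [hj j h, hj (j + 1) (by omega)]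
      exact hDj j h hjk
  · exact R2_ne_zero (by omega)
  · rfl
  · exact hI4
  · exact hIrec
  · rintro _ ⟨c, rfl⟩
    exact (hconst c).2.1
  · rintro _ ⟨c, rfl⟩
    exact (hconst c).2.2.1
  · rintro _ ⟨c, rfl⟩
    exact (hconst c).2.2.2.1
  · rintro _ ⟨c, rfl⟩
    exact (hconst c).2.2.2.2.1
  · rintro _ ⟨c, rfl⟩
    exact (hconst c).2.2.2.2.2
  · intro j hjk
    rcases j.eq_zero_or_pos with rfl | h
    · exact hv1y
    · rw [hj j h]
      exact hv1j j h hjk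
  · intro j h hjk
    rw [hj j h]
    exact hv2j j h hjk
  · intro j h hjk
    rw [hj j (by omega)]
    exact hv3j j h hjk
  · intro j hjk
    simp only [IsDeriv.toDerivation_apply]
    rw [hj (j + 1) (by omega), hv4j (j + 1) (by omega) hjk, hj 1 le_rfl]
    rcases j.eq_zero_or_pos with rfl | h
    · have hD0 : D 0 = 0 := hD.map_zero
      rw [show jetVar k 0 = yK k from rfl, hv4y, hD0, hψ1]
      ring
    · rw [hj j h, hv4j j h hjk.le, hψrec j h hjk]
  · intro j hjk
    rcases j.eq_zero_or_pos with rfl | h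
    · rw [IsDeriv.toDerivation_apply, show jetVar k 0 = yK k from rfl, hv5y]
      push_cast
      ring
    · rw [hj j h]
      exact hv5j j h hjk
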